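/- arXiv:1811.08341 — 6 statements merged into one kernel-verified Lean document; each statement's English description precedes it below -/
import Mathlib

section
/- Let λ be a positive odd integer not divisible by 7. Then for every odd integer n ≥ λ/√14 there exist integers x, y, z, w such that n^2 = x^2 + y^2 + z^2 + w^2 and x + 2y + 3z = λ. -/
theorem exists_shift_abs_le {a : ℤ} (ha : 0 < a) (b : ℤ) :
    ∃ t : ℤ, -a ≤ 2 * (b + a * t) ∧ 2 * (b + a * t) ≤ a := by
  have := Int.emod_add_mul_ediv (2 * b + a) (2 * a)
  have := Int.emod_lt_of_pos (2 * b + a) (show 0 < 2 * a by lia)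
  have := Int.emod_nonneg (2 * b + a) (show 2 * a ≠ 0 by lia)
  exact ⟨-((2 * b + a) / (2 * a)), by linarith, by linarith⟩

/-- A positive definite integral binary quadratic form `a x² + 2 b x y + c y²` properly represents
a positive integer bounded in terms of its determinant. -/
theorem exists_unimodular_binary_le {D : ℤ} (hD : 0 < D) (N : ℕ) :
    ∀ a b c : ℤ, 0 < a → a ≤ N → a * c - b ^ 2 = D →
      ∃ p q r s : ℤ, p * s - q * r = 1 ∧ 0 < a * p ^ 2 + 2 * b * p * r + c * r ^ 2 ∧
        3 * (a * p ^ 2 + 2 * b * p * r + c * r ^ 2) ^ 2 ≤ 4 * D := by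
  induction N with
  | zero => intro a b c h0 h1; exfalso; push_cast at h1; lia
  | succ N ih =>
    intro a b c ha haN hdet
    obtain ⟨t, ht1, ht2⟩ : ∃ t : ℤ, -a ≤ 2 * (b + a * t) ∧ 2 * (b + a * t) ≤ a :=
      exists_shift_abs_le ha b
    set b' := b + a * t with hb'
    set c' := c + 2 * t * b + a * t ^ 2 with hc'
    have hdet' : a * c' - b' ^ 2 = D := by rw [← hdet, hb', hc']; ring
    have hbsq : 4 * b' ^ 2 ≤ a ^ 2 := by nlinarith
    by_cases hlt : c' < a
    · have hc'pos : 0 < c' := by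
        by_contra! h
        nlinarith [sq_nonneg b']
      obtain ⟨p, q, r, s, hu, hpos, hle⟩ := ih c' (-b') a hc'pos (by push_cast at haN; lia)
        (by rw [← hdet']; ring)
      have key : a * (t * p - r) ^ 2 + 2 * b * (t * p - r) * p + c * p ^ 2 =
          c' * p ^ 2 + 2 * (-b') * p * r + a * r ^ 2 := by rw [hb', hc']; ring
      exact ⟨t * p - r, t * q - s, p, q, by linear_combination hu, by rwa [key], by rwa [key]⟩
    · refine ⟨1, 0, 0, 1, by ring, by simpa using ha, ?_⟩
      have : a ^ 2 ≤ a * c' := by nlinarith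
      nlinarith

/-- A positive definite integral binary quadratic form of determinant one takes only values that
are sums of two squares. -/
theorem binary_det_one_sum_two_squares {a b c : ℤ} (ha : 0 < a) (hdet : a * c - b ^ 2 = 1)
    (x y : ℤ) : ∃ u v : ℤ, a * x ^ 2 + 2 * b * x * y + c * y ^ 2 = u ^ 2 + v ^ 2 := by
  obtain ⟨p, q, r, s, hu, hpos, hle⟩ :=
    exists_unimodular_binary_le one_pos a.toNat a b c ha (by lia) hdet
  have h1 : a * p ^ 2 + 2 * b * p * r + c * r ^ 2 = 1 := by nlinarith
  set β := a * p * q + b * (p * s + q * r) + c * r * s with hβ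
  have h2 : (a * q ^ 2 + 2 * b * q * s + c * s ^ 2) - β ^ 2 = 1 := by
    have : (a * p ^ 2 + 2 * b * p * r + c * r ^ 2) * (a * q ^ 2 + 2 * b * q * s + c * s ^ 2) - β ^ 2
        = (a * c - b ^ 2) * (p * s - q * r) ^ 2 := by rw [hβ]; ring
    rw [h1, hdet, hu] at this
    linarith
  refine ⟨(s * x - q * y) + β * (p * y - r * x), p * y - r * x, ?_⟩
  have hx : p * (s * x - q * y) + q * (p * y - r * x) = x := by linear_combination x * hu
  have hy : r * (s * x - q * y) + s * (p * y - r * x) = y := by linear_combination y * hu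
  generalize s * x - q * y = X at *
  generalize p * y - r * x = Y at *
  rw [← hx, ← hy]
  linear_combination X ^ 2 * h1 + Y ^ 2 * h2 - 2 * X * Y * hβ

/-- A positive definite integral ternary quadratic form of determinant one takes only values that
are sums of three squares. -/
theorem ternary_det_one_sum_three_squares (N : ℕ) :
    ∀ a b c d e f : ℤ, 0 < a → a ≤ N → 0 < a * b - f ^ 2 →
      a * b * c + 2 * d * e * f - a * d ^ 2 - b * e ^ 2 - c * f ^ 2 = 1 → ∀ x y z : ℤ,
      ∃ u v w : ℤ, a * x ^ 2 + b * y ^ 2 + c * z ^ 2 + 2 * d * y * z + 2 * e * x * z + 2 * f * x * y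
        = u ^ 2 + v ^ 2 + w ^ 2 := by
  induction N with
  | zero => intro a b c d e f h0 h1; exfalso; push_cast at h1; lia
  | succ N ih =>
    intro a b c d e f ha haN hpos hdet x y z
    have hG : (a * b - f ^ 2) * (a * c - e ^ 2) - (a * d - e * f) ^ 2 = a := by
      linear_combination a * hdet
    obtain rfl | ha1 : a = 1 ∨ 1 < a := by lia
    · obtain ⟨u, v, huv⟩ := binary_det_one_sum_two_squares hpos hG y z
      exact ⟨x + f * y + e * z, u, v, by linear_combination huv⟩
    obtain ⟨p, q, r, s, hu, hgpos, hgle⟩ :=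
      exists_unimodular_binary_le ha (a * b - f ^ 2).toNat _ _ _ hpos (by lia) hG
    set g := (a * b - f ^ 2) * p ^ 2 + 2 * (a * d - e * f) * p * r + (a * c - e ^ 2) * r ^ 2 with hg
    obtain ⟨t, ht1, ht2⟩ := exists_shift_abs_le ha (f * p + e * r)
    set f' := (f * p + e * r) + a * t with hf'
    set e' := f * q + e * s with he'
    set b' := (b * p ^ 2 + 2 * d * p * r + c * r ^ 2) + 2 * t * (f * p + e * r) + a * t ^ 2 with hb'
    set c' := b * q ^ 2 + 2 * d * q * s + c * s ^ 2 with hc'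
    set d' := (b * p * q + d * (p * s + q * r) + c * r * s) + t * e' with hd'
    have hg' : a * b' - f' ^ 2 = g := by rw [hg, hb', hf']; ring
    have hdet' : b' * a * c' + 2 * e' * d' * f' - b' * e' ^ 2 - a * d' ^ 2 - c' * f' ^ 2 = 1 := by
      have : b' * a * c' + 2 * e' * d' * f' - b' * e' ^ 2 - a * d' ^ 2 - c' * f' ^ 2 =
        (a * b * c + 2 * d * e * f - a * d ^ 2 - b * e ^ 2 - c * f ^ 2) * (p * s - q * r) ^ 2 := by
        rw [hb', hc', hd', he', hf']; ring
      rw [this, hdet, hu]; norm_num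
    have hfsq : 4 * f' ^ 2 ≤ a ^ 2 := by nlinarith
    clear_value g f' b' c' d' e'
    have hb'pos : 0 < b' := by
      have : 0 < a * b' := by linarith [sq_nonneg f']
      exact pos_of_mul_pos_right this ha.le
    have hlt : b' < a := by
      by_contra! h
      have h1 : a * a ≤ a * b' := mul_le_mul_of_nonneg_left h ha.le
      have h2 : 2 * a ≤ a * a := mul_le_mul_of_nonneg_right ha1 ha.le
      have h3 : 3 * a ≤ 2 * g := by linarith
      have h4 : 3 * a * (3 * a) ≤ 2 * g * (2 * g) := mul_self_le_mul_self (by linarith) h3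
      linarith
    obtain ⟨u, v, w, huvw⟩ := ih b' a c' e' d' f' hb'pos (by push_cast at haN; lia)
      (by linarith) hdet' (s * y - q * z) (x - t * (s * y - q * z)) (p * z - r * y)
    refine ⟨u, v, w, huvw ▸ ?_⟩
    have hy : p * (s * y - q * z) + q * (p * z - r * y) = y := by linear_combination y * hu
    have hz : r * (s * y - q * z) + s * (p * z - r * y) = z := by linear_combination z * hu
    generalize s * y - q * z = Y at *
    generalize p * z - r * y = Z at *
    rw [← hy, ← hz, hb', hd', hf', hc', he']
    ring

theorem exists_prime_two_mul_add_one_eq (k : ℕ) :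
    ∃ p j : ℕ, p.Prime ∧ 2 * p + 1 = (8 * j + 3) * (8 * k + 5) := by
  have hcop : (12 * k + 7).Coprime (4 * (8 * k + 5)) := by
    refine Nat.Coprime.mul_right ?_ ?_
    · rw [show 4 = 2 ^ 2 by norm_num]
      exact Nat.Coprime.pow_right 2 (Nat.coprime_two_right.2 ⟨6 * k + 3, by ring⟩)
    · rw [← Nat.isCoprime_iff_coprime]
      exact ⟨-2, 3, by push_cast; ring⟩
  obtain ⟨p, hgt, hp, hmod⟩ :=
    Nat.forall_exists_prime_gt_and_modEq (12 * k + 7) (by lia) hcop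
  obtain ⟨j, hj⟩ := (Nat.modEq_iff_dvd' hgt.le).1 hmod.symm
  exact ⟨p, j, hp, by grind⟩

theorem isSquare_neg_zmod_of_two_mul_add_one_eq {p j k : ℕ} [Fact p.Prime]
    (h : 2 * p + 1 = (8 * j + 3) * (8 * k + 5)) : IsSquare ((-(8 * j + 3 : ℕ) : ℤ) : ZMod p) := by
  have hp4 : p % 4 = 3 := by
    have : 2 * p + 1 = 8 * (8 * j * k + 5 * j + 3 * k) + 15 := by rw [h]; ring
    lia
  have hd4 : (8 * j + 3) % 4 = 3 := by lia
  have hodd : Odd p := Nat.odd_iff.2 (by lia)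
  have hdodd : Odd (8 * j + 3) := Nat.odd_iff.2 (by lia)
  have hneg_p : jacobiSym (-1) p = -1 := by
    rw [jacobiSym.at_neg_one hodd, ZMod.χ₄_nat_three_mod_four hp4]
  have hneg_d : jacobiSym (-1) (8 * j + 3) = -1 := by
    rw [jacobiSym.at_neg_one hdodd, ZMod.χ₄_nat_three_mod_four hd4]
  have htwo : jacobiSym 2 (8 * j + 3) = -1 := by
    rw [jacobiSym.at_two hdodd, ZMod.χ₈_nat_eq_if_mod_eight]
    simp [show (8 * j + 3) % 8 = 3 by lia, show (8 * j + 3) % 2 = 1 by lia]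
  have hprod : jacobiSym (2 * p) (8 * j + 3) = jacobiSym (-1) (8 * j + 3) := by
    apply jacobiSym.mod_left'
    apply Int.ModEq.symm
    rw [Int.modEq_iff_dvd]
    have h' : 2 * (p : ℤ) + 1 = (8 * j + 3) * (8 * k + 5) := by exact_mod_cast h
    exact ⟨8 * k + 5, by push_cast; linear_combination h'⟩
  rw [jacobiSym.mul_left, htwo, hneg_d] at hprod
  have hmain : jacobiSym (-(8 * j + 3 : ℕ)) p = 1 := by
    rw [neg_eq_neg_one_mul, jacobiSym.mul_left, hneg_p,
      jacobiSym.quadratic_reciprocity_three_mod_four hd4 hp4]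
    linarith
  exact ZMod.isSquare_of_jacobiSym_eq_one hmain

theorem sum_three_squares_of_five_mod_eight (k : ℕ) :
    ∃ A B C : ℤ, 8 * (k : ℤ) + 5 = A ^ 2 + B ^ 2 + C ^ 2 := by
  obtain ⟨p, j, hp, h⟩ := exists_prime_two_mul_add_one_eq k
  have : Fact p.Prime := ⟨hp⟩
  have h' : 2 * (p : ℤ) + 1 = (8 * j + 3) * (8 * k + 5) := by exact_mod_cast h
  have hpmod : (p : ℤ) % 2 = 1 := by
    have : 2 * (p : ℤ) + 1 = 8 * (8 * j * k + 5 * j + 3 * k) + 15 := by rw [h']; ring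
    lia
  have hpodd : IsCoprime (2 : ℤ) p := ⟨-(p / 2), 1, by lia⟩
  obtain ⟨t, ht2, htp⟩ : ∃ t : ℤ, 2 ∣ t ^ 2 + (8 * j + 3) ∧ (p : ℤ) ∣ t ^ 2 + (8 * j + 3) := by
    obtain ⟨r, hr⟩ := isSquare_neg_zmod_of_two_mul_add_one_eq h
    obtain ⟨t, rfl⟩ := ZMod.intCast_surjective r
    have hdvd : (p : ℤ) ∣ t ^ 2 + (8 * j + 3) := by
      rw [← ZMod.intCast_zmod_eq_zero_iff_dvd]
      push_cast at hr ⊢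
      linear_combination -hr
    have hsq (u : ℤ) (hu : u % 2 = 1) : 2 ∣ u ^ 2 + (8 * j + 3) := by
      obtain ⟨v, rfl⟩ : ∃ v, u = 2 * v + 1 := ⟨u / 2, by lia⟩
      exact ⟨2 * v ^ 2 + 2 * v + 4 * j + 2, by ring⟩
    rcases Int.emod_two_eq_zero_or_one t with ht | ht
    · refine ⟨t + p, hsq _ (by lia), ?_⟩
      rw [show (t + p) ^ 2 + (8 * j + 3) = t ^ 2 + (8 * j + 3) + p * (2 * t + p) by ring]
      exact dvd_add hdvd (dvd_mul_right _ _)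
    · exact ⟨t, hsq t ht, hdvd⟩
  obtain ⟨a, ha⟩ := hpodd.mul_dvd ht2 htp
  have hppos : (0 : ℤ) < p := by exact_mod_cast hp.pos
  have hapos : 0 < a := by
    by_contra! hneg
    nlinarith [sq_nonneg t]
  obtain ⟨A, B, C, hABC⟩ := ternary_det_one_sum_three_squares a.toNat a (2 * p) (8 * k + 5) 0 1 t
    hapos (by lia) (by nlinarith) (by linear_combination -h' - (8 * k + 5) * ha) 0 0 1
  exact ⟨A, B, C, by linear_combination hABC⟩

/-- An integral quaternion whose norm is divisible by `7` is right divisible, modulo `7`, by one of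
the quaternions `2 ± i ± j ± k` of norm `7`. -/
theorem exists_signs_mul_eq_zero_zmod_seven : ∀ a b c d : ZMod 7,
    a ^ 2 + b ^ 2 + c ^ 2 + d ^ 2 = 0 → ∃ e f g : ℤˣ,
      2 * a + b * (e : ℤ) + c * (f : ℤ) + d * (g : ℤ) = 0 ∧
      -a * (e : ℤ) + 2 * b - c * (g : ℤ) + d * (f : ℤ) = 0 ∧
      -a * (f : ℤ) + 2 * c - d * (e : ℤ) + b * (g : ℤ) = 0 ∧
      -a * (g : ℤ) + 2 * d - b * (f : ℤ) + c * (e : ℤ) = 0 := by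
  decide +kernel

/-- If `7 m` is a sum of four squares `a² + b² + c² + d²`, then `m` is a sum of four squares
`x² + y² + z² + w²` with `x + 2 y + 3 z = a - b`. -/
theorem exists_linear_form_eq_sub {a b c d m : ℤ} (h : a ^ 2 + b ^ 2 + c ^ 2 + d ^ 2 = 7 * m) :
    ∃ x y z w : ℤ, m = x ^ 2 + y ^ 2 + z ^ 2 + w ^ 2 ∧ x + 2 * y + 3 * z = a - b := by
  obtain ⟨e, f, g, h0, h1, h2, h3⟩ := exists_signs_mul_eq_zero_zmod_seven a b c d (by
    have := congrArg (Int.cast : ℤ → ZMod 7) h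
    push_cast at this
    rw [this, show (7 : ZMod 7) = 0 from rfl, zero_mul])
  have he : ((e : ℤ)) ^ 2 = 1 := by rcases Int.units_eq_one_or e with rfl | rfl <;> rfl
  have hf : ((f : ℤ)) ^ 2 = 1 := by rcases Int.units_eq_one_or f with rfl | rfl <;> rfl
  have hg : ((g : ℤ)) ^ 2 = 1 := by rcases Int.units_eq_one_or g with rfl | rfl <;> rfl
  obtain ⟨s, hs⟩ : (7 : ℤ) ∣ 2 * a + b * e + c * f + d * g :=
    (ZMod.intCast_zmod_eq_zero_iff_dvd _ 7).1 (by push_cast; exact h0)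
  obtain ⟨t, ht⟩ : (7 : ℤ) ∣ -a * e + 2 * b - c * g + d * f :=
    (ZMod.intCast_zmod_eq_zero_iff_dvd _ 7).1 (by push_cast; exact h1)
  obtain ⟨u, hu⟩ : (7 : ℤ) ∣ -a * f + 2 * c - d * e + b * g :=
    (ZMod.intCast_zmod_eq_zero_iff_dvd _ 7).1 (by push_cast; exact h2)
  obtain ⟨v, hv⟩ : (7 : ℤ) ∣ -a * g + 2 * d - b * f + c * e :=
    (ZMod.intCast_zmod_eq_zero_iff_dvd _ 7).1 (by push_cast; exact h3)
  have hm : m = s ^ 2 + t ^ 2 + u ^ 2 + v ^ 2 := by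
    have : 49 * m = (7 * s) ^ 2 + (7 * t) ^ 2 + (7 * u) ^ 2 + (7 * v) ^ 2 := by
      rw [← hs, ← ht, ← hu, ← hv]
      linear_combination (-7) * h - (a ^ 2 + b ^ 2 + c ^ 2 + d ^ 2) * (he + hf + hg)
    linarith
  have hab : a - b = (2 - e) * s - (e + 2) * t - (f + g) * u + (f - g) * v := by
    have : 7 * (a - b) =
        (2 - e) * (7 * s) - (e + 2) * (7 * t) - (f + g) * (7 * u) + (f - g) * (7 * v) := by
      rw [← hs, ← ht, ← hu, ← hv]
      linear_combination (b - a) * (he + hf + hg)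
    linarith
  clear hs ht hu hv h0 h1 h2 h3 he hf hg
  obtain ⟨x, z, hxz, hxz'⟩ : ∃ x z : ℤ, x + 3 * z = (2 - e) * s - (e + 2) * t ∧
      x ^ 2 + z ^ 2 = s ^ 2 + t ^ 2 := by
    rcases Int.units_eq_one_or e with rfl | rfl
    · exact ⟨s, -t, by push_cast; ring, by ring⟩
    · exact ⟨-t, s, by push_cast; ring, by ring⟩
  obtain ⟨y, w, hyw, hyw'⟩ : ∃ y w : ℤ, 2 * y = -(f + g) * u + (f - g) * v ∧
      y ^ 2 + w ^ 2 = u ^ 2 + v ^ 2 := by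
    rcases Int.units_eq_one_or f with rfl | rfl <;> rcases Int.units_eq_one_or g with rfl | rfl
    · exact ⟨-u, v, by push_cast; ring, by ring⟩
    · exact ⟨v, u, by push_cast; ring, by ring⟩
    · exact ⟨-v, u, by push_cast; ring, by ring⟩
    · exact ⟨u, v, by push_cast; ring, by ring⟩
  exact ⟨x, y, z, w, by linarith, by linarith⟩

theorem exists_linear_form_eq_of_parity {l A B C m : ℤ}
    (h : l ^ 2 + A ^ 2 + B ^ 2 + C ^ 2 = 14 * m) (hA : Even (l + A)) (hB : Even (B + C)) :
    ∃ x y z w : ℤ, m = x ^ 2 + y ^ 2 + z ^ 2 + w ^ 2 ∧ x + 2 * y + 3 * z = l := by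
  obtain ⟨a, ha⟩ := hA
  obtain ⟨d, hd⟩ := hB
  obtain rfl : A = 2 * a - l := by linarith
  obtain rfl : B = 2 * d - C := by linarith
  obtain ⟨x, y, z, w, hm, hl⟩ := exists_linear_form_eq_sub (a := a) (b := a - l) (c := d - C)
    (d := d) (m := m) (by linarith)
  exact ⟨x, y, z, w, hm, by linarith⟩

theorem square_as_four_squares_with_linear_form
    (lam : ℤ) (hpos : 0 < lam) (hodd : Odd lam) (h7 : ¬ (7 ∣ lam))
    (n : ℤ) (hnodd : Odd n) (hn : (n : ℝ) ≥ (lam : ℝ) / Real.sqrt 14) :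
    ∃ x y z w : ℤ,
      n ^ 2 = x ^ 2 + y ^ 2 + z ^ 2 + w ^ 2 ∧ x + 2 * y + 3 * z = lam := by
  have hle : lam ^ 2 ≤ 14 * n ^ 2 := by
    have h1 : (lam : ℝ) ≤ n * Real.sqrt 14 := (div_le_iff₀ (by positivity)).1 hn
    have h2 : (lam : ℝ) ^ 2 ≤ (n * Real.sqrt 14) ^ 2 :=
      pow_le_pow_left₀ (by exact_mod_cast hpos.le) h1 2
    rw [mul_pow, Real.sq_sqrt (by norm_num)] at h2
    have h3 : (lam : ℝ) ^ 2 ≤ 14 * n ^ 2 := by linarith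
    exact_mod_cast h3
  have hl8 := Int.eight_dvd_sq_sub_one_of_odd hodd
  have hn8 := Int.eight_dvd_sq_sub_one_of_odd hnodd
  obtain ⟨k, hk⟩ : ∃ k : ℕ, 14 * n ^ 2 - lam ^ 2 = 8 * (k : ℤ) + 5 :=
    ⟨((14 * n ^ 2 - lam ^ 2) / 8).toNat, by lia⟩
  obtain ⟨A, B, C, hABC⟩ := sum_three_squares_of_five_mod_eight k
  have hsum : lam ^ 2 + A ^ 2 + B ^ 2 + C ^ 2 = 14 * n ^ 2 := by linarith
  have hsq (u : ℤ) : (Even u ∧ u ^ 2 % 4 = 0) ∨ (Odd u ∧ u ^ 2 % 4 = 1) := by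
    rcases Int.even_or_odd u with hu | hu
    · exact .inl ⟨hu, Int.emod_eq_zero_of_dvd (pow_dvd_pow_of_dvd hu.two_dvd 2)⟩
    · exact .inr ⟨hu, Int.sq_mod_four_eq_one_of_odd hu⟩
  rcases hsq A with ⟨hA, hA4⟩ | ⟨hA, hA4⟩ <;> rcases hsq B with ⟨hB, hB4⟩ | ⟨hB, hB4⟩ <;>
    rcases hsq C with ⟨hC, hC4⟩ | ⟨hC, hC4⟩ <;> try (exfalso; lia)
  · exact exists_linear_form_eq_of_parity (A := C) (B := A) (C := B) (by linarith)
      (hodd.add_odd hC) (hA.add hB)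
  · exact exists_linear_form_eq_of_parity (A := B) (B := A) (C := C) (by linarith)
      (hodd.add_odd hB) (hA.add hC)
  · exact exists_linear_form_eq_of_parity hsum (hodd.add_odd hA) (hB.add hC)
end

section
/- Let k be a positive integer. Every even integer n > a_k(3,2) with n ≡ 2 (mod 4) can be written as n = x^2 + y^2 + z^2 + w^2 with x, y, z, w nonnegative integers satisfying x + y + z + w = (2b)^k for some nonnegative integer b. -/
noncomputable def aBound (k j l : ℕ) : ℝ :=
  (2 * k * l) ^ (2 * k) * (j + 1) ^ (2 * k - 1)

noncomputable def bBound (k j l : ℕ) : ℝ :=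
  (1 / j) * Real.exp (2 * (k : ℝ) ^ ((3 : ℝ) / 2) * (j : ℝ) ^ ((1 : ℝ) / (4 * k)) *
    ((j : ℝ) + 1) ^ ((2 * (k : ℝ) - 1) / (4 * k)))

noncomputable def cBound (k j l : ℕ) : ℝ :=
  max (aBound k j l) (max (bBound k j l) ((3275 : ℝ) ^ (2 * k) / j))

/-- The value at `(x, y, z)` of the ternary quadratic form whose symmetric matrix has rows
`(a, b, c)`, `(b, d, e)`, `(c, e, f)`. -/
def ternaryForm (a b c d e f x y z : ℤ) : ℤ :=
  a * x ^ 2 + 2 * b * x * y + 2 * c * x * z + d * y ^ 2 + 2 * e * y * z + f * z ^ 2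

lemma exists_abs_two_mul_add_mul_le {a : ℤ} (ha : 0 < a) (b : ℤ) :
    ∃ t : ℤ, -a ≤ 2 * (b + t * a) ∧ 2 * (b + t * a) ≤ a := by
  refine ⟨-((2 * b + a) / (2 * a)), ?_⟩
  have h1 := Int.emod_add_mul_ediv (2 * b + a) (2 * a)
  have h2 := Int.emod_nonneg (2 * b + a) (by omega : 2 * a ≠ 0)
  have h3 := Int.emod_lt_of_pos (2 * b + a) (by omega : 0 < 2 * a)
  constructor <;> nlinarith

/-- Gauss reduction of a positive definite binary quadratic form `a x² + 2 b x y + c y²`. -/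
lemma exists_reduced_binary (a b c : ℤ) (ha : 0 < a) (hD : 0 < a * c - b ^ 2) :
    ∃ p q r s : ℤ, p * s - q * r = 1 ∧
      0 < a * p ^ 2 + 2 * b * p * r + c * r ^ 2 ∧
      3 * (a * p ^ 2 + 2 * b * p * r + c * r ^ 2) ^ 2 ≤ 4 * (a * c - b ^ 2) ∧
      |2 * (a * p * q + b * (p * s + q * r) + c * r * s)| ≤
        a * p ^ 2 + 2 * b * p * r + c * r ^ 2 := by
  induction hN : a.toNat using Nat.strong_induction_on generalizing a b c with
  | _ N ih =>
    obtain ⟨t, ht1, ht2⟩ := exists_abs_two_mul_add_mul_le ha b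
    set B := b + t * a with hB
    set C := a * t ^ 2 + 2 * b * t + c with hC
    have hdet : a * C - B ^ 2 = a * c - b ^ 2 := by rw [hB, hC]; ring
    by_cases hle : a ≤ C
    · refine ⟨1, t, 0, 1, by ring, by nlinarith, ?_, ?_⟩
      · have h4 : 4 * B ^ 2 ≤ a ^ 2 := by nlinarith
        nlinarith
      · rw [abs_le]
        constructor <;> nlinarith
    · have hCpos : 0 < C := by
        by_contra h
        nlinarith [sq_nonneg B]
      obtain ⟨p, q, r, s, h1, h2, h3, h4⟩ :=
        ih C.toNat (by omega) C (-B) a hCpos (by nlinarith) rfl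
      have e1 : a * (t * p - r) ^ 2 + 2 * b * (t * p - r) * p + c * p ^ 2 =
          C * p ^ 2 + 2 * (-B) * p * r + a * r ^ 2 := by rw [hB, hC]; ring
      have e2 : a * (t * p - r) * (t * q - s) + b * ((t * p - r) * q + (t * q - s) * p)
          + c * p * q = C * p * q + (-B) * (p * s + q * r) + a * r * s := by rw [hB, hC]; ring
      refine ⟨t * p - r, t * q - s, p, q, by linarith, ?_, ?_, ?_⟩
      · rw [e1]; exact h2
      · rw [e1]; linarith
      · rw [e1, e2]; exact h4

lemma eq_one_of_hermite_bounds {a G : ℤ} (ha : 0 < a) (hG : 0 < G) (hGa : 3 * G ^ 2 ≤ 4 * a)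
    (haG : 3 * a ^ 2 ≤ 4 * G) : a = 1 ∧ G = 1 := by
  have h : 3 * (a + G) ≤ 8 := by
    by_contra hlt
    nlinarith [sq_nonneg (a - G)]
  have : a ≤ 2 := by omega
  have : G ≤ 2 := by omega
  interval_cases a <;> interval_cases G <;> omega

/-- A positive definite integral ternary quadratic form of determinant one represents only sums of
three squares. -/
lemma ternaryForm_eq_sum_three_squares (a b c d e f : ℤ) (ha : 0 < a) (hg : 0 < a * d - b ^ 2)
    (hdet : a * d * f + 2 * b * c * e - a * e ^ 2 - d * c ^ 2 - f * b ^ 2 = 1) (x y z : ℤ) :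
    ∃ u v w : ℤ, ternaryForm a b c d e f x y z = u ^ 2 + v ^ 2 + w ^ 2 := by
  induction hN : a.toNat using Nat.strong_induction_on generalizing a b c d e f x y z with
  | _ N ih =>
    have hgdet : (a * d - b ^ 2) * (a * f - c ^ 2) - (a * e - b * c) ^ 2 = a := by
      linear_combination a * hdet
    obtain ⟨p, q, r, s, h1, h2, h3, h4⟩ :=
      exists_reduced_binary (a * d - b ^ 2) (a * e - b * c) (a * f - c ^ 2) hg (by omega)
    rw [hgdet] at h3
    set G := (a * d - b ^ 2) * p ^ 2 + 2 * (a * e - b * c) * p * r + (a * f - c ^ 2) * r ^ 2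
      with hG
    set H := (a * d - b ^ 2) * p * q + (a * e - b * c) * (p * s + q * r) + (a * f - c ^ 2) * r * s
      with hH
    set K := (a * d - b ^ 2) * q ^ 2 + 2 * (a * e - b * c) * q * s + (a * f - c ^ 2) * s ^ 2
      with hK
    have hGHK : G * K - H ^ 2 = a := by
      have : G * K - H ^ 2 = (p * s - q * r) ^ 2 *
          ((a * d - b ^ 2) * (a * f - c ^ 2) - (a * e - b * c) ^ 2) := by
        rw [hG, hH, hK]; ring
      rw [this, h1, hgdet]; ring
    obtain ⟨t, ht1, ht2⟩ := exists_abs_two_mul_add_mul_le ha (b * p + c * r)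
    set b₁ := b * p + c * r with hb₁
    set c₁ := b * q + c * s with hc₁
    set d₁ := d * p ^ 2 + 2 * e * p * r + f * r ^ 2 with hd₁
    set e₁ := d * p * q + e * (p * s + q * r) + f * r * s with he₁
    set f₁ := d * q ^ 2 + 2 * e * q * s + f * s ^ 2 with hf₁
    set b₂ := b₁ + t * a with hb₂
    set d₂ := d₁ + 2 * t * b₁ + t ^ 2 * a with hd₂
    set e₂ := e₁ + t * c₁ with he₂
    have hG₂ : a * d₂ - b₂ ^ 2 = G := by
      rw [hd₂, hb₂, hG, hd₁, hb₁]; ring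
    have hH₂ : a * e₂ - b₂ * c₁ = H := by
      rw [he₂, hb₂, hH, he₁, hb₁, hc₁]; ring
    have hK₂ : a * f₁ - c₁ ^ 2 = K := by
      rw [hK, hf₁, hc₁]; ring
    obtain ⟨X, Y, Z, hval⟩ : ∃ X Y Z : ℤ,
        ternaryForm a b c d e f x y z = ternaryForm a b₂ c₁ d₂ e₂ f₁ X Y Z := by
      refine ⟨x - t * (s * y - q * z), s * y - q * z, p * z - r * y, ?_⟩
      have hy : p * (s * y - q * z) + q * (p * z - r * y) = y := by linear_combination y * h1
      have hz : r * (s * y - q * z) + s * (p * z - r * y) = z := by linear_combination z * h1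
      conv_lhs => rw [← hy, ← hz]
      simp only [ternaryForm, hb₂, hd₂, he₂, hb₁, hc₁, hd₁, he₁, hf₁]
      ring
    rw [hval]
    by_cases hlt : d₂ < a
    · have hd₂pos : 0 < d₂ := (mul_pos_iff_of_pos_left ha).1 (by linarith [sq_nonneg b₂])
      obtain ⟨u, v, w, h⟩ := ih d₂.toNat (by omega) d₂ b₂ e₂ a c₁ f₁ hd₂pos (by linarith) (by
        apply mul_left_cancel₀ ha.ne'
        rw [← hG₂, ← hH₂, ← hK₂] at hGHK
        linear_combination hGHK) Y X Z rfl
      refine ⟨u, v, w, ?_⟩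
      rw [← h]
      simp only [ternaryForm]
      ring
    · have hb4 : (2 * b₂) ^ 2 ≤ a ^ 2 := sq_le_sq' ht1 ht2
      have had : a * a ≤ a * d₂ := mul_le_mul_of_nonneg_left (not_lt.1 hlt) ha.le
      have hGa : 3 * a ^ 2 ≤ 4 * G := by linarith
      obtain ⟨ha1, hG1⟩ := eq_one_of_hermite_bounds ha h2 h3 hGa
      have hH0 : H = 0 := by
        rw [hG1, abs_le] at h4
        omega
      have hK1 : K = 1 := by
        rw [hG1, hH0, ha1] at hGHK
        linarith
      refine ⟨X + b₂ * Y + c₁ * Z, Y, Z, ?_⟩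
      rw [hG1] at hG₂
      rw [hH0] at hH₂
      rw [hK1] at hK₂
      rw [ha1] at hG₂ hH₂ hK₂ ⊢
      simp only [ternaryForm]
      linear_combination Y ^ 2 * hG₂ + 2 * Y * Z * hH₂ + Z ^ 2 * hK₂

/-- A case of the three squares theorem: its proof follows Dirichlet. -/
lemma exists_sum_three_squares_of_mod_four_eq_two {m : ℕ} (hm : m % 4 = 2) :
    ∃ u v w : ℤ, (m : ℤ) = u ^ 2 + v ^ 2 + w ^ 2 := by
  have hcop : (m - 1).Coprime (4 * m) := by
    apply Nat.Coprime.mul_right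
    · have : (m - 1).Coprime 2 := by
        rw [Nat.coprime_two_right, Nat.odd_iff]; omega
      exact this.pow_right 2
    · exact (Nat.coprime_self_sub_left (by omega : 1 ≤ m)).2 (Nat.coprime_one_left m)
  obtain ⟨p, hpgt, hp, hpmod⟩ :=
    Nat.forall_exists_prime_gt_and_modEq (4 * m) (by omega : 4 * m ≠ 0) hcop
  have := Fact.mk hp
  obtain ⟨j, hj⟩ : 4 * m ∣ p - (m - 1) := (Nat.modEq_iff_dvd' (by omega)).1 hpmod.symm
  have hpm : p + 1 = (4 * j + 1) * m := by
    have : (4 * j + 1) * m = 4 * m * j + m := by ring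
    omega
  have hp4 : p % 4 = 1 := by
    have : p + 1 = 4 * (m * j) + m := by rw [hpm]; ring
    omega
  have hjac : jacobiSym (-((4 * j + 1 : ℕ) : ℤ)) p = 1 := by
    have hmod : (p : ℤ) % ((4 * j + 1 : ℕ) : ℤ) = (-1) % ((4 * j + 1 : ℕ) : ℤ) := by
      refine (Int.modEq_iff_dvd.2 ⟨m, ?_⟩).symm
      rw [sub_neg_eq_add]
      exact_mod_cast hpm
    rw [neg_eq_neg_one_mul, jacobiSym.mul_left, jacobiSym.at_neg_one (Nat.odd_iff.2 (by omega)),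
      ZMod.χ₄_nat_one_mod_four hp4, one_mul,
      ← jacobiSym.quadratic_reciprocity_one_mod_four hp4 (Nat.odd_iff.2 (by omega)),
      jacobiSym.mod_left, hmod, ← jacobiSym.mod_left,
      jacobiSym.at_neg_one (Nat.odd_iff.2 (by omega)), ZMod.χ₄_nat_one_mod_four (by omega)]
  rw [← jacobiSym.legendreSym.to_jacobiSym] at hjac
  have hne : ((-((4 * j + 1 : ℕ) : ℤ) : ℤ) : ZMod p) ≠ 0 := by
    intro h0
    rw [(legendreSym.eq_zero_iff p _).2 h0] at hjac
    exact zero_ne_one hjac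
  obtain ⟨r, hr⟩ := (legendreSym.eq_one_iff p hne).1 hjac
  obtain ⟨c, rfl⟩ := ZMod.intCast_surjective r
  obtain ⟨a, ha⟩ : (p : ℤ) ∣ c ^ 2 + (4 * j + 1 : ℕ) := by
    rw [← ZMod.intCast_zmod_eq_zero_iff_dvd]
    push_cast at hr ⊢
    linear_combination -hr
  have hpm' : (p : ℤ) + 1 = (4 * j + 1) * m := by exact_mod_cast hpm
  have hppos : (0 : ℤ) < p := by exact_mod_cast hp.pos
  push_cast at ha
  have hapos : 0 < a := by
    by_contra h
    nlinarith [sq_nonneg c]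
  obtain ⟨u, v, w, h⟩ := ternaryForm_eq_sum_three_squares a c 1 p 0 m hapos
    (by nlinarith) (by linear_combination (-m : ℤ) * ha - hpm') 0 0 1
  exact ⟨u, v, w, by rw [← h]; simp [ternaryForm]⟩

/-- A variant of Cauchy's lemma. -/
lemma exists_sum_four_squares_of_sum_eq {n σ : ℕ} (hn : n % 4 = 2) (hσ : Even σ) (hle : σ ^ 2 ≤ n)
    (hlt : 3 * n < 3 * σ ^ 2 + (σ + 2) ^ 2) :
    ∃ x y z w : ℕ, n = x ^ 2 + y ^ 2 + z ^ 2 + w ^ 2 ∧ x + y + z + w = 2 * σ := by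
  obtain ⟨m, rfl⟩ := Nat.exists_eq_add_of_le hle
  have hσ4 : σ ^ 2 % 4 = 0 := by
    obtain ⟨τ, rfl⟩ := hσ
    have : (τ + τ) ^ 2 = 4 * τ ^ 2 := by ring
    omega
  obtain ⟨u, v, w, h⟩ := exists_sum_three_squares_of_mod_four_eq_two (by omega : m % 4 = 2)
  have hbound : ∀ a b c : ℤ, a ^ 2 + b ^ 2 + c ^ 2 = m → a + b + c < σ + 2 := by
    intro a b c habc
    have hlt' : (3 * m : ℤ) < (σ + 2) ^ 2 := by
      have : 3 * m < (σ + 2) ^ 2 := by omega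
      exact_mod_cast this
    apply lt_of_pow_lt_pow_left₀ 2 (by positivity)
    nlinarith [sq_nonneg (a - b), sq_nonneg (a - c), sq_nonneg (b - c)]
  have heven : Even ((σ : ℤ) + u + v + w) := by
    have hm2 : Even (m : ℤ) := by exact_mod_cast Nat.even_iff.2 (by omega)
    have hσ2 : Even (σ : ℤ) := by exact_mod_cast hσ
    rw [h] at hm2
    simp only [Int.even_add, Int.even_pow, ne_eq, OfNat.ofNat_ne_zero, not_false_eq_true,
      and_true] at hm2 ⊢
    tauto
  obtain ⟨x, hx⟩ := heven
  have h1 := hbound (-u) (-v) (-w) (by rw [h]; ring)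
  have h2 := hbound (-u) v w (by rw [h]; ring)
  have h3 := hbound u (-v) w (by rw [h]; ring)
  have h4 := hbound u v (-w) (by rw [h]; ring)
  lift x to ℕ using by omega
  obtain ⟨y, hy⟩ := Int.eq_ofNat_of_zero_le (by omega : 0 ≤ x - v - w)
  obtain ⟨z, hz⟩ := Int.eq_ofNat_of_zero_le (by omega : 0 ≤ x - u - w)
  obtain ⟨t, ht⟩ := Int.eq_ofNat_of_zero_le (by omega : 0 ≤ x - u - v)
  refine ⟨x, y, z, t, ?_, by omega⟩
  zify
  rw [← hy, ← hz, ← ht, h]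
  have hσx : (σ : ℤ) = 2 * x - u - v - w := by omega
  rw [hσx]
  ring

lemma exists_sum_four_squares_of_sixty_four_lt {n : ℕ} (hmod : n % 4 = 2) (hn : 64 < n) :
    ∃ x y z w b : ℕ, n = x ^ 2 + y ^ 2 + z ^ 2 + w ^ 2 ∧ x + y + z + w = 2 * b := by
  by_cases h98 : n = 98
  · exact ⟨9, 4, 1, 0, 7, by omega, by norm_num⟩
  have h1 : 4 * (n / 4).sqrt ^ 2 ≤ n := by
    have := Nat.sqrt_le' (n / 4)
    omega
  have h2 : n < 4 * ((n / 4).sqrt + 1) ^ 2 := by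
    have := Nat.lt_succ_sqrt' (n / 4)
    rw [Nat.succ_eq_add_one] at this
    omega
  set τ := (n / 4).sqrt
  have hτ : 4 ≤ τ := by
    by_contra h
    have : (τ + 1) ^ 2 ≤ 4 ^ 2 := Nat.pow_le_pow_left (by omega) 2
    omega
  obtain ⟨x, y, z, w, hsq, hsum⟩ := exists_sum_four_squares_of_sum_eq (σ := 2 * τ) hmod
    (even_two_mul τ) (by linarith [mul_pow 2 τ 2]) (by
      obtain h | h : τ = 4 ∨ 5 ≤ τ := by omega
      · rw [h] at h2 ⊢
        omega
      · nlinarith)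
  exact ⟨x, y, z, w, 2 * τ, hsq, hsum⟩

/-- Above `(16 k) ^ (2 k)`, ratio `4 / 3` leaves room for the `2 k`-th power of an even number. -/
lemma exists_even_pow_mem_Icc {k n : ℕ} (hk : 0 < k) (hn : (16 * k) ^ (2 * k) < 4 * n) :
    ∃ b : ℕ, (2 * b) ^ (2 * k) ≤ 4 * n ∧ 3 * n ≤ (2 * b) ^ (2 * k) := by
  have h2k : 2 * k ≠ 0 := by omega
  have hex : ∃ b, 4 * n < (2 * (b + 1)) ^ (2 * k) := by
    refine ⟨4 * n, ?_⟩
    calc 4 * n < 2 * (4 * n + 1) := by omega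
      _ ≤ _ := Nat.le_self_pow h2k _
  classical
  have hspec := Nat.find_spec hex
  have hmin := fun m => @Nat.find_min _ _ hex m
  set b := Nat.find hex
  refine ⟨b, ?_, ?_⟩
  · rcases Nat.eq_zero_or_pos b with h0 | hpos
    · rw [h0, mul_zero, zero_pow h2k]
      exact Nat.zero_le _
    · have := hmin (b - 1) (by omega)
      rw [Nat.sub_add_cancel hpos] at this
      exact not_lt.1 this
  · have hb : 16 * k < 2 * (b + 1) := lt_of_pow_lt_pow_left₀ (2 * k) (Nat.zero_le _) (hn.trans hspec)
    have hbR : (16 * k : ℝ) < 2 * (b + 1) := by exact_mod_cast hb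
    have hkR : (1 : ℝ) ≤ k := by exact_mod_cast hk
    have hpos : (0 : ℝ) < b + 1 := by positivity
    have hinv : (1 : ℝ) / (b + 1) * (8 * k) ≤ 1 := by
      rw [div_mul_eq_mul_div, one_mul, div_le_one hpos]
      linarith
    have hinv1 : (1 : ℝ) / (b + 1) ≤ 1 := by
      rw [div_le_one hpos]
      linarith [(Nat.cast_nonneg b : (0 : ℝ) ≤ b)]
    have hbern := one_add_mul_le_pow (by linarith : (-2 : ℝ) ≤ -(1 / (b + 1))) (2 * k)
    push_cast at hbern
    have hquarter : (3 / 4 : ℝ) ≤ (1 + -(1 / ((b : ℝ) + 1))) ^ (2 * k) := by linarith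
    have hfac : (2 * b : ℝ) = 2 * (b + 1) * (1 + -(1 / ((b : ℝ) + 1))) := by
      field_simp
      ring
    have hspecR : (4 * n : ℝ) ≤ (2 * (b + 1)) ^ (2 * k) := by exact_mod_cast hspec.le
    have : (3 * n : ℝ) ≤ (2 * b) ^ (2 * k) := by
      rw [hfac, mul_pow]
      calc (3 * n : ℝ) = 4 * n * (3 / 4) := by ring
        _ ≤ _ := mul_le_mul hspecR hquarter (by norm_num) (by positivity)
    exact_mod_cast this

lemma pow_lt_four_mul_of_aBound_lt {k n : ℕ} (hk : 0 < k) (hn : aBound k 3 2 < n) :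
    (16 * k) ^ (2 * k) < 4 * n := by
  have h : (aBound k 3 2) * 4 = (16 * k) ^ (2 * k) := by
    have h4 : ((3 : ℕ) + 1 : ℝ) ^ (2 * k - 1) * 4 = 4 ^ (2 * k) := by
      rw [show ((3 : ℕ) + 1 : ℝ) = 4 by norm_num]
      exact pow_sub_one_mul (by omega) 4
    rw [aBound, mul_assoc, h4, ← mul_pow]
    congr 1
    push_cast
    ring
  have : ((16 * k : ℝ)) ^ (2 * k) < 4 * n := by linarith
  exact_mod_cast this

theorem four_squares_sum_even_power (k : ℕ) (hk : 0 < k) (n : ℕ)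
    (hmod : n % 4 = 2) (hn : (n : ℝ) > aBound k 3 2) :
    ∃ x y z w b : ℕ,
      n = x ^ 2 + y ^ 2 + z ^ 2 + w ^ 2 ∧ x + y + z + w = (2 * b) ^ k := by
  have hpow := pow_lt_four_mul_of_aBound_lt hk hn
  obtain rfl | hk2 : k = 1 ∨ 2 ≤ k := by omega
  · simpa only [pow_one] using
      exists_sum_four_squares_of_sixty_four_lt hmod (by norm_num at hpow; omega)
  obtain ⟨b, hle, hge⟩ := exists_even_pow_mem_Icc hk hpow
  obtain ⟨l, rfl⟩ := Nat.exists_eq_add_of_le hk2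
  obtain ⟨σ, hσ⟩ : ∃ σ, σ = 2 * (b ^ 2 * (2 * b) ^ l) := ⟨_, rfl⟩
  have hs : (2 * b) ^ (2 + l) = 2 * σ := by rw [hσ]; ring
  have hs2 : (2 * b) ^ (2 * (2 + l)) = 4 * σ ^ 2 := by
    rw [mul_comm 2 (2 + l), pow_mul, hs]; ring
  rw [hs2] at hle hge
  obtain ⟨x, y, z, w, hsq, hsum⟩ :=
    exists_sum_four_squares_of_sum_eq hmod (hσ ▸ even_two_mul _) (by omega) (by nlinarith)
  exact ⟨x, y, z, w, b, hsq, hsum.trans hs.symm⟩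
end

section
/- Let λ be a positive odd integer. Then for each integer n ≥ λ^2/16, the number 80n − 5λ^2 can be written as a^2 + 10b^2 + 16c^2 with integers a, b, c satisfying a ≡ −λ (mod 8), b ≡ λ (mod 4), c + 2a ≡ 0 (mod 5), and a + 2b ≡ 9λ (mod 16). -/
open scoped NumberTheorySymbols in
/-- If `p ≡ 1 mod 4` is prime and `p + 1` is divisible by `b ≡ 1 mod 4`, then `-b` is a square
modulo `p`. -/
theorem exists_dvd_sq_add_of_mod_four {p b n : ℕ} (hp : p.Prime) (hp4 : p % 4 = 1) (hb1 : b % 4 = 1)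
    (h : p + 1 = b * n) : ∃ m : ℤ, (p : ℤ) ∣ m ^ 2 + b := by
  have : Fact p.Prime := ⟨hp⟩
  have hb : Odd b := Nat.odd_iff.2 (by omega)
  have hpo : Odd p := Nat.odd_iff.2 (by omega)
  have hmod : J((p : ℤ) | b) = J(-1 | b) := by
    refine jacobiSym.mod_left' (Int.ModEq.symm (Int.modEq_iff_dvd.2 ⟨n, ?_⟩))
    rw [sub_neg_eq_add]
    exact_mod_cast h
  have hpb : J((p : ℤ) | b) = J((b : ℤ) | p) :=
    jacobiSym.quadratic_reciprocity_one_mod_four hp4 hb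
  have hJ : J(-(b : ℤ) | p) = 1 := by
    rw [jacobiSym.neg _ hpo, ← hpb, hmod, ZMod.χ₄_nat_one_mod_four hp4, one_mul,
      jacobiSym.at_neg_one hb, ZMod.χ₄_nat_one_mod_four hb1]
  obtain ⟨y, hy⟩ := ZMod.isSquare_of_jacobiSym_eq_one hJ
  obtain ⟨m, rfl⟩ := ZMod.intCast_surjective y
  refine ⟨m, (ZMod.intCast_zmod_eq_zero_iff_dvd _ p).1 ?_⟩
  push_cast at hy ⊢
  rw [sq, ← hy, neg_add_cancel]

/-- Division with remainder of least absolute value. -/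
theorem Int.exists_two_mul_sub_mem_Icc (h : ℤ) {g : ℤ} (hg : 0 < g) :
    ∃ k : ℤ, 2 * (h - k * g) ≤ g ∧ -g ≤ 2 * (h - k * g) := by
  refine ⟨(2 * h + g) / (2 * g), ?_⟩
  have h1 := Int.emod_add_mul_ediv (2 * h + g) (2 * g)
  have h2 := Int.emod_nonneg (2 * h + g) (b := 2 * g) (by omega)
  have h3 := Int.emod_lt_of_pos (2 * h + g) (b := 2 * g) (by omega)
  constructor <;> nlinarith

/-- Every value of a positive definite integral ternary quadratic form of determinant one is a sum
of three squares. -/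
theorem exists_sum_three_sq_of_ternary_form (a b c r s t : ℤ) (ha : 0 < a)
    (hG : 0 < a * b - t ^ 2)
    (hdet : a * b * c + 2 * r * s * t - a * r ^ 2 - b * s ^ 2 - c * t ^ 2 = 1) (x y z : ℤ) :
    ∃ u v w : ℤ, a * x ^ 2 + b * y ^ 2 + c * z ^ 2 + 2 * r * y * z + 2 * s * x * z + 2 * t * x * y
      = u ^ 2 + v ^ 2 + w ^ 2 := by
  induction hA : a.toNat using Nat.strong_induction_on generalizing a b c r s t x y z with
  | _ A ihA =>
  induction hB : (a * b - t ^ 2).toNat using Nat.strong_induction_on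
    generalizing b c r s t x y z with
  | _ B ihB =>
  obtain ⟨k, hk1, hk2⟩ := Int.exists_two_mul_sub_mem_Icc (a * r - s * t) hG
  have hGK : (a * b - t ^ 2) * (a * (c - 2 * k * r + k ^ 2 * b) - (s - k * t) ^ 2) =
      a + (a * r - s * t - k * (a * b - t ^ 2)) ^ 2 := by
    linear_combination a * hdet
  have hK : 0 < a * (c - 2 * k * r + k ^ 2 * b) - (s - k * t) ^ 2 := by
    refine pos_of_mul_pos_right ?_ hG.le
    rw [hGK]; positivity
  by_cases hKG : a * (c - 2 * k * r + k ^ 2 * b) - (s - k * t) ^ 2 < a * b - t ^ 2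
  · obtain ⟨u, v, w, h⟩ := ihB _ (by omega) (c - 2 * k * r + k ^ 2 * b) b (r - k * b) t (s - k * t)
      hK (by linear_combination hdet) x z (y + k * z) rfl
    exact ⟨u, v, w, by rw [← h]; ring⟩
  obtain ⟨l, hl1, hl2⟩ := Int.exists_two_mul_sub_mem_Icc t ha
  have hb' : 0 < b - 2 * l * t + l ^ 2 * a := by
    refine pos_of_mul_pos_right (a := a) ?_ ha.le
    nlinarith [sq_nonneg (t - l * a)]
  by_cases hba : b - 2 * l * t + l ^ 2 * a < a
  · obtain ⟨u, v, w, h⟩ := ihA _ (by omega) (b - 2 * l * t + l ^ 2 * a) a c s (r - l * s) (t - l * a)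
      hb' (by linarith) (by linear_combination hdet) y (x + l * y) z rfl
    exact ⟨u, v, w, by rw [← h]; ring⟩
  have hGa : 3 * (a * b - t ^ 2) ^ 2 ≤ 4 * a := by nlinarith
  have haG : 3 * a ^ 2 ≤ 4 * (a * b - t ^ 2) := by nlinarith
  have hG2 : a * b - t ^ 2 < 2 := by nlinarith
  have hG1 : a * b - t ^ 2 = 1 := by omega
  have ha1 : a = 1 := by nlinarith
  subst ha1
  refine ⟨x + t * y + s * z, y + (r - s * t) * z, z, ?_⟩
  obtain rfl : b = 1 + t ^ 2 := by linarith
  linear_combination z ^ 2 * hdet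

/-- Every positive integer congruent to `2` modulo `4` is a sum of three squares. -/
theorem exists_sum_three_sq_of_mod_four_eq_two {n : ℕ} (hn : n % 4 = 2) :
    ∃ u v w : ℤ, (n : ℤ) = u ^ 2 + v ^ 2 + w ^ 2 := by
  have hcop : (n - 1).Coprime (4 * n) := by
    refine Nat.Coprime.mul_right ?_ ?_
    · have : Nat.Coprime (n - 1) 2 := Nat.coprime_two_right.2 (Nat.odd_iff.2 (by omega))
      exact this.pow_right 2
    · obtain ⟨m, rfl⟩ : ∃ m, n = m + 1 := ⟨n - 1, by omega⟩
      simp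
  obtain ⟨p, hpn, hp, hmod⟩ := Nat.forall_exists_prime_gt_and_modEq n (by omega) hcop
  obtain ⟨v, hv⟩ := (Nat.modEq_iff_dvd' (by omega)).1 hmod.symm
  have hpb : p + 1 = (4 * v + 1) * n := by
    have : p = 4 * n * v + (n - 1) := by omega
    rw [this, add_mul, one_mul, mul_right_comm]
    omega
  have hp4 : p % 4 = 1 := by
    have : p = 4 * (n * v) + (n - 1) := by rw [← mul_assoc]; omega
    omega
  obtain ⟨m, a, ha⟩ := exists_dvd_sq_add_of_mod_four hp hp4 (by omega) hpb
  have hp0 : (0 : ℤ) < p := by exact_mod_cast hp.pos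
  zify at hpb
  push_cast at ha
  have ha0 : 0 < a := by
    refine pos_of_mul_pos_right (a := (p : ℤ)) ?_ hp0.le
    rw [← ha]; positivity
  obtain ⟨u, v, w, h⟩ := exists_sum_three_sq_of_ternary_form a p n 0 1 m ha0
    (by linarith) (by linear_combination (-n : ℤ) * ha - hpb) 0 0 1
  exact ⟨u, v, w, by linarith⟩

/-- Every positive integer congruent to `7` modulo `8` has the form `u ^ 2 + v ^ 2 + 2 * b ^ 2`
with `u` odd and `v` even. -/
theorem exists_sq_add_sq_add_two_mul_sq {m : ℤ} (hm0 : 0 < m) (hm : m % 8 = 7) :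
    ∃ u v b : ℤ, m = u ^ 2 + v ^ 2 + 2 * b ^ 2 ∧ Odd u ∧ Even v := by
  have key : ∃ u v b : ℤ, m = u ^ 2 + v ^ 2 + 2 * b ^ 2 := by
    obtain ⟨x, y, z, h⟩ := exists_sum_three_sq_of_mod_four_eq_two (n := (2 * m).toNat) (by omega)
    rw [Int.toNat_of_nonneg (by omega)] at h
    have of_even : ∀ x y z : ℤ, 2 * m = x ^ 2 + y ^ 2 + z ^ 2 → Even x →
        ∃ u v b : ℤ, m = u ^ 2 + v ^ 2 + 2 * b ^ 2 := by
      rintro x y z h ⟨b, rfl⟩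
      have hyz : Even (y + z) := by
        have : Even (y ^ 2 + z ^ 2) := ⟨m - 2 * b ^ 2, by linarith⟩
        simpa [Int.even_add, Int.even_pow] using this
      obtain ⟨u, hu⟩ := hyz
      obtain rfl : z = 2 * u - y := by linarith
      exact ⟨u, y - u, b, by linarith⟩
    rcases Int.even_or_odd x with hx | hx
    · exact of_even x y z h hx
    rcases Int.even_or_odd y with hy | hy
    · exact of_even y x z (by linarith) hy
    refine of_even z x y (by linarith) ?_
    have : Even (x ^ 2 + y ^ 2 + z ^ 2) := ⟨m, by linarith⟩
    simpa [Int.even_add, Int.even_pow, Int.not_even_iff_odd.2 hx, Int.not_even_iff_odd.2 hy]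
      using this
  obtain ⟨u, v, b, h⟩ := key
  have hodd : Odd (u ^ 2 + v ^ 2) := Int.odd_iff.2 (by omega)
  rcases Int.even_or_odd u with hu | hu
  · refine ⟨v, u, b, by linarith, ?_, hu⟩
    simpa [Int.odd_add, Int.odd_pow, Int.even_pow, hu, Int.not_odd_iff_even.2 hu] using hodd
  · refine ⟨u, v, b, h, hu, ?_⟩
    simpa [Int.odd_add, Int.odd_pow, Int.even_pow, hu] using hodd

/-- An odd number agrees, up to sign, with any given odd number modulo `4`. -/
theorem Int.exists_sq_eq_and_emod_four_eq {b l : ℤ} (hb : Odd b) (hl : Odd l) :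
    ∃ b' : ℤ, b' ^ 2 = b ^ 2 ∧ b' % 4 = l % 4 := by
  rw [Int.odd_iff] at hb hl
  rcases (by omega : b % 4 = l % 4 ∨ (-b) % 4 = l % 4) with h | h
  · exact ⟨b, rfl, h⟩
  · exact ⟨-b, neg_sq b, h⟩

theorem Int.sq_emod_sixteen_of_odd {w : ℤ} (hw : Odd w) :
    w ^ 2 % 16 = 1 ∧ (w % 8 = 1 ∨ w % 8 = 7) ∨ w ^ 2 % 16 = 9 ∧ (w % 8 = 3 ∨ w % 8 = 5) := by
  have hsq : w ^ 2 % 16 = (w % 8) ^ 2 % 16 := by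
    refine (Int.modEq_iff_dvd.2 ⟨4 * (w / 8) ^ 2 + (w / 8) * (w % 8), ?_⟩ :
      (w % 8) ^ 2 ≡ w ^ 2 [ZMOD 16]).symm
    have := Int.emod_add_mul_ediv w 8
    linear_combination (-(w + (w % 8 + 8 * (w / 8)))) * this
  rw [Int.odd_iff] at hw
  rcases (by omega : w % 8 = 1 ∨ w % 8 = 3 ∨ w % 8 = 5 ∨ w % 8 = 7) with h | h | h | h <;>
    rw [hsq, h] <;> norm_num

theorem ternary_form_congruence_conditions_A
    (lam : ℤ) (hpos : 0 < lam) (hodd : Odd lam)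
    (n : ℤ) (hn : (n : ℝ) ≥ (lam : ℝ) ^ 2 / 16) :
    ∃ a b c : ℤ,
      80 * n - 5 * lam ^ 2 = a ^ 2 + 10 * b ^ 2 + 16 * c ^ 2 ∧
        a ≡ -lam [ZMOD 8] ∧ b ≡ lam [ZMOD 4] ∧
        c + 2 * a ≡ 0 [ZMOD 5] ∧ a + 2 * b ≡ 9 * lam [ZMOD 16] := by
  have hle : lam ^ 2 ≤ 16 * n := by
    have : (lam : ℝ) ^ 2 ≤ 16 * n := by linarith
    exact_mod_cast this
  have hlam := Int.sq_emod_sixteen_of_odd hodd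
  obtain ⟨u, v, b, h, hu, ⟨x, rfl⟩⟩ :=
    exists_sq_add_sq_add_two_mul_sq (m := 16 * n - lam ^ 2) (by omega) (by omega)
  have husq := Int.sq_emod_sixteen_of_odd hu
  have h' : 16 * n - lam ^ 2 = u ^ 2 + 4 * x ^ 2 + 2 * b ^ 2 := by linarith
  have hb : Odd b := by
    have : Odd (b ^ 2) := Int.odd_iff.2 (by omega)
    simpa [Int.odd_pow] using this
  have hbsq := Int.sq_emod_sixteen_of_odd hb
  have hx : Odd x := by
    have : Odd (x ^ 2) := Int.odd_iff.2 (by omega)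
    simpa [Int.odd_pow] using this
  have hxsq := Int.sq_emod_sixteen_of_odd hx
  obtain ⟨b', hb', hb4⟩ := Int.exists_sq_eq_and_emod_four_eq hb hodd
  obtain ⟨u', hu', hu8⟩ : ∃ u' : ℤ, u' ^ 2 = u ^ 2 ∧ u' % 8 = 3 * lam % 8 := by
    have h16 : (lam ^ 2 % 16 = 1 ∧ u ^ 2 % 16 = 9) ∨ (lam ^ 2 % 16 = 9 ∧ u ^ 2 % 16 = 1) := by
      omega
    clear h h' hbsq hxsq
    rcases (by omega : u % 8 = 3 * lam % 8 ∨ (-u) % 8 = 3 * lam % 8) with h8 | h8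
    · exact ⟨u, rfl, h8⟩
    · exact ⟨-u, neg_sq u, h8⟩
  clear hlam husq hbsq hxsq hle
  rw [Int.odd_iff] at hodd hx
  obtain ⟨x', hx', hx4⟩ := Int.exists_sq_eq_and_emod_four_eq (Int.odd_iff.2 hx)
    (l := (9 * lam - u' - 2 * b') / 4) (Int.odd_iff.2 (by omega))
  obtain ⟨c, hc⟩ : ∃ c, u' - x' = 2 * c := ⟨(u' - x') / 2, by omega⟩
  refine ⟨u' + 4 * x', b', c, ?_, ?_, hb4, ?_, ?_⟩
  · linear_combination 5 * h' - 5 * hu' - 20 * hx' - 10 * hb' + 4 * (u' - x' + 2 * c) * hc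
  all_goals
    clear h h' hu' hb' hx'
    unfold Int.ModEq
    omega
end

section
/- Let λ be a positive odd integer. Then for each integer n ≥ λ^2/8, the number 88n − 11λ^2 can be written as a^2 + 8b^2 + 44c^2 with integers a, b, c satisfying a + 5b ≡ 0 (mod 11), c odd, and a ≡ λ (mod 8). -/
/-- `n` is represented by a positive definite integral ternary form of determinant one, with
diagonal coefficients `a, b, c` and off-diagonal matrix entries `d, e, g`, whose first two leading
principal minors are `a` and `a * b - d ^ 2`. -/
def UnimodularTernaryRep (n a b c d e g : ℤ) : Prop :=
  0 < a ∧ 0 < a * b - d ^ 2 ∧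
    a * b * c + 2 * d * e * g - a * g ^ 2 - b * e ^ 2 - c * d ^ 2 = 1 ∧
    ∃ x y z : ℤ,
      n = a * x ^ 2 + b * y ^ 2 + c * z ^ 2 + 2 * d * x * y + 2 * e * x * z + 2 * g * y * z

namespace UnimodularTernaryRep

variable {n a b c d e g : ℤ}

theorem swap_first (h : UnimodularTernaryRep n a b c d e g) :
    UnimodularTernaryRep n b a c d g e := by
  obtain ⟨ha, hG, hdet, x, y, z, hn⟩ := h
  refine ⟨?_, by linarith, by linarith, y, x, z, by linarith⟩
  have : 0 < a * b := by nlinarith [sq_nonneg d]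
  exact pos_of_mul_pos_right this ha.le

theorem minor_mul_minor (h : UnimodularTernaryRep n a b c d e g) :
    (a * b - d ^ 2) * (a * c - e ^ 2) = a + (a * g - d * e) ^ 2 := by
  linear_combination a * h.2.2.1

theorem swap_last (h : UnimodularTernaryRep n a b c d e g) :
    UnimodularTernaryRep n a c b e d g := by
  have hm := h.minor_mul_minor
  obtain ⟨ha, hG, hdet, x, y, z, hn⟩ := h
  refine ⟨ha, ?_, by linarith, x, z, y, by linarith⟩
  have : 0 < (a * b - d ^ 2) * (a * c - e ^ 2) := by rw [hm]; positivity
  exact pos_of_mul_pos_right this hG.le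

theorem shear_first (h : UnimodularTernaryRep n a b c d e g) (k : ℤ) :
    UnimodularTernaryRep n a (b + 2 * k * d + k ^ 2 * a) c (d + k * a) e (g + k * e) := by
  obtain ⟨ha, hG, hdet, x, y, z, hn⟩ := h
  refine ⟨ha, ?_, ?_, x - k * y, y, z, ?_⟩
  · linarith
  · linear_combination hdet
  · linear_combination hn

theorem shear_last (h : UnimodularTernaryRep n a b c d e g) (k : ℤ) :
    UnimodularTernaryRep n a b (c + 2 * k * g + k ^ 2 * b) d (e + k * d) (g + k * b) := by
  obtain ⟨ha, hG, hdet, x, y, z, hn⟩ := h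
  refine ⟨ha, hG, ?_, x, y - k * z, z, ?_⟩
  · linear_combination hdet
  · linear_combination hn

end UnimodularTernaryRep

theorem exists_two_mul_abs_add_mul_le (d : ℤ) {a : ℤ} (ha : 0 < a) :
    ∃ k : ℤ, 2 * |d + k * a| ≤ a := by
  have h₁ := Int.emod_nonneg (2 * d + a) (b := 2 * a) (by omega)
  have h₂ := Int.emod_lt_of_pos (2 * d + a) (b := 2 * a) (by omega)
  have h₃ := Int.emod_add_mul_ediv (2 * d + a) (2 * a)
  generalize (2 * d + a) / (2 * a) = q at h₃
  refine ⟨-q, ?_⟩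
  rcases abs_cases (d + -q * a) with h | h <;> rw [h.1] <;> nlinarith

namespace UnimodularTernaryRep

variable {n a b c d e g : ℤ}

theorem sum_three_squares_of_reduced (h : UnimodularTernaryRep n a b c d e g)
    (hd : 2 * |d| ≤ a) (hK : 2 * |a * g - d * e| ≤ a * b - d ^ 2)
    (hab : a ≤ b) (hbc : a * b - d ^ 2 ≤ a * c - e ^ 2) :
    ∃ x y z : ℤ, n = x ^ 2 + y ^ 2 + z ^ 2 := by
  have hm := h.minor_mul_minor
  obtain ⟨ha, hG, hdet, x, y, z, hn⟩ := h
  have hd' : 4 * d ^ 2 ≤ a ^ 2 := by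
    have := abs_nonneg d
    rw [← sq_abs d]
    nlinarith
  have hK' : 4 * (a * g - d * e) ^ 2 ≤ (a * b - d ^ 2) ^ 2 := by
    have := abs_nonneg (a * g - d * e)
    rw [← sq_abs (a * g - d * e)]
    nlinarith
  have h₁ : 3 * a ^ 2 ≤ 4 * (a * b - d ^ 2) := by nlinarith
  have h₂ : 3 * (a * b - d ^ 2) ^ 2 ≤ 4 * a := by nlinarith
  have ha₁ : a = 1 := by
    by_contra hne
    have h2a : 2 ≤ a := by omega
    have h3 : 3 * a ≤ 2 * (a * b - d ^ 2) := by nlinarith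
    nlinarith
  subst ha₁
  have hd₀ : d = 0 := by
    have : |d| = 0 := by have := abs_nonneg d; omega
    simpa using this
  subst hd₀
  have hb₁ : b = 1 := by nlinarith
  subst hb₁
  have hg₀ : g = 0 := by
    have : |g| = 0 := by
      have := abs_nonneg g
      norm_num at hK
      omega
    simpa using this
  subst hg₀
  exact ⟨x + e * z, y, z, by linear_combination hn + z ^ 2 * hdet⟩

theorem sum_three_squares (h : UnimodularTernaryRep n a b c d e g) :
    ∃ x y z : ℤ, n = x ^ 2 + y ^ 2 + z ^ 2 := by
  induction hm : (a + (a * b - d ^ 2)).toNat using Nat.strong_induction_on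
    generalizing a b c d e g with
  | _ m ih =>
  obtain ⟨k, hk⟩ := exists_two_mul_abs_add_mul_le d h.1
  have h' := h.shear_first k
  obtain ⟨l, hl⟩ := exists_two_mul_abs_add_mul_le
    (a * (g + k * e) - (d + k * a) * e) h'.2.1
  have h'' := h'.shear_last l
  have hK : a * (g + k * e + l * (b + 2 * k * d + k ^ 2 * a)) -
      (d + k * a) * (e + l * (d + k * a)) =
      a * (g + k * e) - (d + k * a) * e +
        l * (a * (b + 2 * k * d + k ^ 2 * a) - (d + k * a) ^ 2) := by ring
  have hG : a * (b + 2 * k * d + k ^ 2 * a) - (d + k * a) ^ 2 = a * b - d ^ 2 := by ring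
  rw [← hK] at hl
  rw [← hG] at hm
  have hpos := h''.1
  have hpos' := h''.2.1
  by_cases hab : a ≤ b + 2 * k * d + k ^ 2 * a
  · by_cases hbc : a * (b + 2 * k * d + k ^ 2 * a) - (d + k * a) ^ 2 ≤
        a * (c + 2 * l * (g + k * e) + l ^ 2 * (b + 2 * k * d + k ^ 2 * a)) -
          (e + l * (d + k * a)) ^ 2
    · exact h''.sum_three_squares_of_reduced hk hl hab hbc
    · exact ih _ (by omega) h''.swap_last rfl
  · refine ih _ ?_ h''.swap_first rfl
    rw [mul_comm (b + 2 * k * d + k ^ 2 * a) a]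
    omega

end UnimodularTernaryRep

open NumberTheorySymbols in
theorem exists_unimodularTernaryRep {n : ℕ} (hn : n % 4 = 2) :
    ∃ a b c d e g : ℤ, UnimodularTernaryRep n a b c d e g := by
  have hcop : (n - 1).Coprime (4 * n) := by
    have h₁ : (n - 1).Coprime n := by
      have := Nat.coprime_self_add_right (m := n - 1) (n := 1)
      rw [Nat.sub_add_cancel (by omega)] at this
      exact this.2 (Nat.coprime_one_right _)
    have h₂ : (n - 1).Coprime 4 := by
      have : (n - 1).Coprime (2 ^ 2) :=
        Nat.Coprime.pow_right 2 (Nat.coprime_two_right.2 (Nat.odd_iff.2 (by omega)))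
      simpa using this
    exact h₂.mul_right h₁
  obtain ⟨p, hgt, hp, hmod⟩ :=
    Nat.forall_exists_prime_gt_and_modEq n (q := 4 * n) (by omega) hcop
  obtain ⟨m, hm⟩ := (Nat.modEq_iff_dvd' (by omega)).1 hmod.symm
  have hpm : p + 1 = (4 * m + 1) * n := by
    have : p = 4 * n * m + (n - 1) := by omega
    have h1 : n - 1 + 1 = n := by omega
    calc p + 1 = 4 * n * m + (n - 1 + 1) := by omega
      _ = _ := by rw [h1]; ring
  have hp4 : p % 4 = 1 := by
    have : p + 1 = 4 * (m * n) + n := by rw [hpm]; ring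
    omega
  have : Fact p.Prime := ⟨hp⟩
  have hb4 : (4 * m + 1) % 4 = 1 := by omega
  have hJ : J(-((4 * m + 1 : ℕ) : ℤ) | p) = 1 := by
    rw [jacobiSym.neg _ (Nat.odd_iff.2 (by omega)), ZMod.χ₄_nat_one_mod_four hp4, one_mul,
      jacobiSym.quadratic_reciprocity_one_mod_four hb4 (Nat.odd_iff.2 (by omega)),
      ← ZMod.χ₄_nat_one_mod_four hb4, ← jacobiSym.at_neg_one (Nat.odd_iff.2 (by omega))]
    apply jacobiSym.mod_left'
    apply Int.ModEq.symm
    rw [Int.modEq_iff_dvd]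
    exact ⟨n, by push_cast; zify at hpm; linarith⟩
  rw [← jacobiSym.legendreSym.to_jacobiSym] at hJ
  have hsq : IsSquare ((-((4 * m + 1 : ℕ) : ℤ) : ℤ) : ZMod p) := by
    refine (legendreSym.eq_one_iff p fun h0 => ?_).1 hJ
    rw [(legendreSym.eq_zero_iff p _).2 h0] at hJ
    exact zero_ne_one hJ
  obtain ⟨r, hr⟩ := hsq
  obtain ⟨r, rfl⟩ := ZMod.intCast_surjective r
  rw [← Int.cast_mul, ZMod.intCast_eq_intCast_iff_dvd_sub] at hr
  obtain ⟨t, ht⟩ := hr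
  push_cast at ht
  zify at hpm
  have hp0 : (0 : ℤ) < p := by exact_mod_cast hp.pos
  refine ⟨t, p, n, r, 1, 0, ?_, ?_, ?_, 0, 0, 1, by ring⟩
  · have : (0 : ℤ) < p * t := by rw [← ht]; nlinarith [mul_self_nonneg r]
    exact pos_of_mul_pos_right this hp0.le
  · nlinarith
  · linear_combination -n * ht - hpm

theorem Nat.sum_three_squares_of_mod_four_eq_two {n : ℕ} (hn : n % 4 = 2) :
    ∃ x y z : ℤ, (n : ℤ) = x ^ 2 + y ^ 2 + z ^ 2 := by
  obtain ⟨a, b, c, d, e, g, h⟩ := exists_unimodularTernaryRep hn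
  exact h.sum_three_squares

theorem Int.sq_emod_eight_of_odd {x : ℤ} (hx : Odd x) : x ^ 2 % 8 = 1 := by
  obtain ⟨k, rfl⟩ := hx
  obtain ⟨l, hl⟩ := Int.even_mul_succ_self k
  have : (2 * k + 1) ^ 2 = 8 * l + 1 := by linear_combination 4 * hl
  omega

theorem Int.odd_or_even_with_sq_emod (x : ℤ) :
    Odd x ∧ x ^ 2 % 8 = 1 ∨ Even x ∧ x ^ 2 % 4 = 0 := by
  rcases Int.even_or_odd x with hx | hx
  · refine Or.inr ⟨hx, ?_⟩
    obtain ⟨k, rfl⟩ := hx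
    ring_nf
    omega
  · exact Or.inl ⟨hx, Int.sq_emod_eight_of_odd hx⟩

theorem odd_of_sq_add_two_mul_sq_add_four_mul_sq {t s c : ℤ}
    (h : (t ^ 2 + 2 * s ^ 2 + 4 * c ^ 2) % 8 = 7) : Odd t ∧ Odd s ∧ Odd c := by
  rcases Int.odd_or_even_with_sq_emod t with ⟨ht, ht'⟩ | ⟨ht, ht'⟩ <;>
    rcases Int.odd_or_even_with_sq_emod s with ⟨hs, hs'⟩ | ⟨hs, hs'⟩ <;>
    rcases Int.odd_or_even_with_sq_emod c with ⟨hc, hc'⟩ | ⟨hc, hc'⟩ <;>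
    first | exact ⟨ht, hs, hc⟩ | omega

theorem exists_odd_of_two_mul_eq_sum_three_squares {N p q r : ℤ} (hN8 : N % 8 = 7)
    (h : 2 * N = p ^ 2 + q ^ 2 + r ^ 2) (hp : Odd p) (hq : Odd q) (hr : Even r) :
    ∃ t s c : ℤ, Odd t ∧ Odd s ∧ Odd c ∧ N = t ^ 2 + 2 * s ^ 2 + 4 * c ^ 2 := by
  obtain ⟨i, rfl⟩ := hp
  obtain ⟨j, rfl⟩ := hq
  obtain ⟨s, rfl⟩ := hr
  have hN : N = (i + j + 1) ^ 2 + (i - j) ^ 2 + 2 * s ^ 2 := by linarith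
  have : ∃ t c : ℤ, N = t ^ 2 + 2 * s ^ 2 + 4 * c ^ 2 := by
    rcases Int.even_or_odd (i - j) with ⟨c, hc⟩ | ⟨c, hc⟩
    · exact ⟨i + j + 1, c, by rw [hN, hc]; ring⟩
    · refine ⟨i - j, j + c + 1, ?_⟩
      rw [hN, show i + j + 1 = 2 * (j + c + 1) by omega]
      ring
  obtain ⟨t, c, rfl⟩ := this
  obtain ⟨ht, hs, hc⟩ := odd_of_sq_add_two_mul_sq_add_four_mul_sq hN8
  exact ⟨t, s, c, ht, hs, hc, rfl⟩

theorem exists_odd_sq_add_two_mul_sq_add_four_mul_sq {N : ℤ} (hN : 0 ≤ N) (hN8 : N % 8 = 7) :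
    ∃ t s c : ℤ, Odd t ∧ Odd s ∧ Odd c ∧ N = t ^ 2 + 2 * s ^ 2 + 4 * c ^ 2 := by
  obtain ⟨p, q, r, h⟩ :=
    Nat.sum_three_squares_of_mod_four_eq_two (n := (2 * N).toNat) (by omega)
  rw [Int.toNat_of_nonneg (by omega)] at h
  rcases Int.odd_or_even_with_sq_emod p with ⟨hp, hp'⟩ | ⟨hp, hp'⟩ <;>
    rcases Int.odd_or_even_with_sq_emod q with ⟨hq, hq'⟩ | ⟨hq, hq'⟩ <;>
    rcases Int.odd_or_even_with_sq_emod r with ⟨hr, hr'⟩ | ⟨hr, hr'⟩ <;> try omega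
  · exact exists_odd_of_two_mul_eq_sum_three_squares hN8 h hp hq hr
  · exact exists_odd_of_two_mul_eq_sum_three_squares hN8 (by linarith) hp hr hq
  · exact exists_odd_of_two_mul_eq_sum_three_squares hN8 (by linarith) hq hr hp

theorem exists_sign_change_modEq_eight {t s m : ℤ} (ht : Odd t) (hs : Odd s) (hm : Odd m) :
    ∃ t' s' : ℤ, Odd t' ∧ Odd s' ∧ t' ^ 2 = t ^ 2 ∧ s' ^ 2 = s ^ 2 ∧
      -2 * s' - 3 * t' ≡ m [ZMOD 8] := by
  have : (-2 * s - 3 * t) % 8 = m % 8 ∨ (-2 * -s - 3 * t) % 8 = m % 8 ∨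
      (-2 * s - 3 * -t) % 8 = m % 8 ∨ (-2 * -s - 3 * -t) % 8 = m % 8 := by
    rw [Int.odd_iff] at ht hs hm
    have ht' : t % 8 = 1 ∨ t % 8 = 3 ∨ t % 8 = 5 ∨ t % 8 = 7 := by omega
    have hs' : s % 4 = 1 ∨ s % 4 = 3 := by omega
    have hm' : m % 8 = 1 ∨ m % 8 = 3 ∨ m % 8 = 5 ∨ m % 8 = 7 := by omega
    rcases ht' with ht' | ht' | ht' | ht' <;> rcases hs' with hs' | hs' <;>
      rcases hm' with hm' | hm' | hm' | hm' <;> omega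
  rcases this with h | h | h | h
  · exact ⟨t, s, ht, hs, rfl, rfl, h⟩
  · exact ⟨t, -s, ht, hs.neg, rfl, neg_sq s, h⟩
  · exact ⟨-t, s, ht.neg, hs, neg_sq t, rfl, h⟩
  · exact ⟨-t, -s, ht.neg, hs.neg, neg_sq t, neg_sq s, h⟩

theorem ternary_form_congruence_conditions_B
    (lam : ℤ) (hpos : 0 < lam) (hodd : Odd lam)
    (n : ℤ) (hn : (n : ℝ) ≥ (lam : ℝ) ^ 2 / 8) :
    ∃ a b c : ℤ,
      88 * n - 11 * lam ^ 2 = a ^ 2 + 8 * b ^ 2 + 44 * c ^ 2 ∧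
        a + 5 * b ≡ 0 [ZMOD 11] ∧ Odd c ∧ a ≡ lam [ZMOD 8] := by
  have hN : 0 ≤ 8 * n - lam ^ 2 := by
    have : (0 : ℝ) ≤ 8 * n - lam ^ 2 := by linarith
    exact_mod_cast this
  have hlam := Int.sq_emod_eight_of_odd hodd
  obtain ⟨t₀, s₀, c, ht₀, hs₀, hc, h⟩ :=
    exists_odd_sq_add_two_mul_sq_add_four_mul_sq hN (by omega)
  obtain ⟨t, s, ht, hs, htt, hss, hmod⟩ := exists_sign_change_modEq_eight ht₀ hs₀ hodd
  rw [← htt, ← hss] at h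
  obtain ⟨b, hb⟩ : Even (3 * s - t) := by
    rw [Int.odd_iff] at ht hs
    rw [Int.even_iff]
    omega
  refine ⟨-2 * s - 3 * t, b, c, ?_, ?_, hc, hmod⟩
  · linear_combination 11 * h + 2 * (3 * s - t + 2 * b) * hb
  · rw [Int.modEq_zero_iff_dvd]
    omega
end

section
/- Let n, j, k, l be positive integers and let I_{j,k} denote the open real interval ((−1 + √(j(n−1)))^{1/k}, (√((j+1)n))^{1/k}). If n > a_k(j,l), then the length of I_{j,k} is greater than l. -/
theorem sqrt_mul_le_sqrt_succ_mul {j m : ℝ} (hj : 0 < j) (hm : 0 ≤ m) :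
    √(j * m) ≤ √((j + 1) * m) * (1 - 1 / (2 * (j + 1))) := by
  have h1 : 1 / (2 * (j + 1)) ≤ 1 := by
    rw [div_le_one (by positivity)]; linarith
  apply Real.sqrt_le_iff.2
  refine ⟨mul_nonneg (Real.sqrt_nonneg _) (by linarith), ?_⟩
  rw [mul_pow, Real.sq_sqrt (by positivity)]
  have h2 : (j + 1) * m * (1 - 1 / (2 * (j + 1))) ^ 2 = j * m + m / (4 * (j + 1)) := by
    field_simp
    ring
  rw [h2]
  have : 0 ≤ m / (4 * (j + 1)) := by positivity
  linarith

theorem lt_sub_of_pow_le {x y l c : ℝ} {k : ℕ} (hk : 0 < k) (hl : 0 < l) (hc : 1 ≤ c)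
    (hx : k * l * c < x) (hy : y ^ k ≤ x ^ k * (1 - 1 / c)) : l < x - y := by
  by_contra! hxy
  have hk1 : (1 : ℝ) ≤ k := by exact_mod_cast hk
  have hc0 : 0 < c := by linarith
  have hlx : l < x := by
    have h1 : l ≤ k * l := le_mul_of_one_le_left hl.le hk1
    have h2 : k * l ≤ k * l * c := le_mul_of_one_le_right (by positivity) hc
    linarith
  have hx0 : 0 < x := hl.trans hlx
  have hpow : (x - l) ^ k ≤ y ^ k := pow_le_pow_left₀ (by linarith) (by linarith) k
  have hratio : l / x ≤ 1 := (div_le_one hx0).2 hlx.le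
  have hbern := one_add_mul_le_pow (a := -(l / x)) (by linarith) k
  have hfac : (x - l) ^ k = x ^ k * (1 + -(l / x)) ^ k := by
    rw [← mul_pow]
    congr 1
    field_simp
    ring
  have hsmall : k * (l / x) < 1 / c := by
    rw [← mul_div_assoc, div_lt_div_iff₀ hx0 hc0]
    linarith
  have hlt : x ^ k * (1 - 1 / c) < x ^ k * (1 + -(l / x)) ^ k :=
    mul_lt_mul_of_pos_left (by linarith) (by positivity)
  linarith

theorem interval_length_gt (n j k l : ℕ) (hn : 0 < n) (hj : 0 < j)
    (hk : 0 < k) (hl : 0 < l) (h : (n : ℝ) > aBound k j l) :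
    ((Real.sqrt ((j + 1) * n)) ^ ((1 : ℝ) / k) -
        (-1 + Real.sqrt (j * ((n : ℝ) - 1))) ^ ((1 : ℝ) / k)) > l := by
  have hj1 : (1 : ℝ) ≤ j := by exact_mod_cast hj
  have hk1 : (1 : ℝ) ≤ k := by exact_mod_cast hk
  have hl1 : (1 : ℝ) ≤ l := by exact_mod_cast hl
  have hn0 : (0 : ℝ) ≤ n := n.cast_nonneg
  have hkl : (1 : ℝ) ≤ 2 * k * l := by nlinarith
  rw [gt_iff_lt, aBound] at h
  have hn1 : (1 : ℝ) < n :=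
    (one_le_mul_of_one_le_of_one_le (one_le_pow₀ hkl) (one_le_pow₀ (by linarith))).trans_lt h
  have hn2 : (2 : ℝ) ≤ n := by
    have : 1 < n := by exact_mod_cast hn1
    exact_mod_cast this
  have hB : 0 ≤ -1 + √((j : ℝ) * ((n : ℝ) - 1)) := by
    have : (1 : ℝ) ≤ √((j : ℝ) * ((n : ℝ) - 1)) := Real.one_le_sqrt.2 (by nlinarith)
    linarith
  have hBle : -1 + √((j : ℝ) * ((n : ℝ) - 1)) ≤ √((j : ℝ) * n) := by
    have : √((j : ℝ) * ((n : ℝ) - 1)) ≤ √((j : ℝ) * n) := Real.sqrt_le_sqrt (by nlinarith)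
    linarith
  rw [one_div]
  have hxk := Real.rpow_inv_natCast_pow (Real.sqrt_nonneg (((j : ℝ) + 1) * n)) hk.ne'
  have hyk := Real.rpow_inv_natCast_pow hB hk.ne'
  refine lt_sub_of_pow_le (c := 2 * ((j : ℝ) + 1)) hk (by linarith) (by linarith) ?_ ?_
  · refine lt_of_pow_lt_pow_left₀ (2 * k) (by positivity) ?_
    rw [mul_comm 2 k, pow_mul (_ ^ _) k 2, hxk, Real.sq_sqrt (by positivity)]
    have hexp : k * 2 = (2 * k - 1) + 1 := by omega
    calc ((k : ℝ) * l * (2 * (j + 1))) ^ (k * 2)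
        = (j + 1) * ((2 * k * l) ^ (2 * k) * (j + 1) ^ (2 * k - 1)) := by
          rw [show (k : ℝ) * l * (2 * (j + 1)) = (2 * k * l) * (j + 1) by ring, mul_pow,
            mul_comm 2 k, hexp, pow_succ ((j : ℝ) + 1), Nat.add_sub_cancel]
          ring
      _ < (j + 1) * n := mul_lt_mul_of_pos_left h (by positivity)
  · rw [hxk, hyk]
    exact hBle.trans (sqrt_mul_le_sqrt_succ_mul (by linarith) hn0)
end

section
/- For any nonnegative integers a, b, c, d with a^2 + b^2 + c^2 + d^2 ≠ 0, there is no finite subset S of the nonnegative integers such that every sufficiently large integer n can be written as n = x^2 + y^2 + z^2 + w^2 with x, y, z, w nonnegative integers satisfying ax + by + cz + dw ∈ S; that is, for every finite S ⊆ ℕ and every N there exists n > N admitting no such representation. -/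
/-- If `8` divides a sum of four squares, then the first of them is the square of an even number. -/
theorem even_of_eight_dvd_sum_four_squares {x y z w : ℕ}
    (h : 8 ∣ x ^ 2 + y ^ 2 + z ^ 2 + w ^ 2) : 2 ∣ x := by
  have key : ∀ a b c d : ZMod 8, a ^ 2 + b ^ 2 + c ^ 2 + d ^ 2 = 0 → 4 * a = 0 := by decide
  have h0 : (x : ZMod 8) ^ 2 + (y : ZMod 8) ^ 2 + (z : ZMod 8) ^ 2 + (w : ZMod 8) ^ 2 = 0 := by
    exact_mod_cast (ZMod.natCast_eq_zero_iff _ 8).2 h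
  have h1 : ((4 * x : ℕ) : ZMod 8) = 0 := by
    exact_mod_cast key x y z w h0
  have h2 := (ZMod.natCast_eq_zero_iff _ 8).1 h1
  omega

/-- Every term of a representation of `4 ^ r * 28` as a sum of four squares is at least `2 ^ r`. -/
theorem two_pow_le_of_sum_four_squares (r : ℕ) {x y z w : ℕ}
    (h : 4 ^ r * 28 = x ^ 2 + y ^ 2 + z ^ 2 + w ^ 2) : 2 ^ r ≤ x := by
  induction r generalizing x y z w with
  | zero =>
    rw [pow_zero, Nat.one_le_iff_ne_zero]
    rintro rfl
    have hy : y < 6 := by nlinarith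
    have hz : z < 6 := by nlinarith
    have hw : w < 6 := by nlinarith
    interval_cases y <;> interval_cases z <;> interval_cases w <;> omega
  | succ r ih =>
    have h8 : 8 ∣ x ^ 2 + y ^ 2 + z ^ 2 + w ^ 2 := ⟨4 ^ r * 14, by rw [← h]; ring⟩
    obtain ⟨x, rfl⟩ := even_of_eight_dvd_sum_four_squares h8
    obtain ⟨y, rfl⟩ : 2 ∣ y :=
      even_of_eight_dvd_sum_four_squares (y := 2 * x) (z := z) (w := w) (by convert h8 using 1; ring)
    obtain ⟨z, rfl⟩ : 2 ∣ z :=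
      even_of_eight_dvd_sum_four_squares (y := 2 * x) (z := 2 * y) (w := w)
        (by convert h8 using 1; ring)
    obtain ⟨w, rfl⟩ : 2 ∣ w :=
      even_of_eight_dvd_sum_four_squares (y := 2 * x) (z := 2 * y) (w := 2 * z)
        (by convert h8 using 1; ring)
    have := ih (x := x) (y := y) (z := z) (w := w) (by rw [pow_succ] at h; linarith)
    rw [pow_succ]
    omega

theorem no_finite_restriction_set (a b c d : ℕ)
    (h : a ^ 2 + b ^ 2 + c ^ 2 + d ^ 2 ≠ 0) (S : Finset ℕ) (N : ℕ) :
    ∃ n : ℕ, n > N ∧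
      ¬ ∃ x y z w : ℕ, n = x ^ 2 + y ^ 2 + z ^ 2 + w ^ 2 ∧
        a * x + b * y + c * z + d * w ∈ S := by
  set M := S.sup id
  set r := N + M
  have hr : r < 2 ^ r := Nat.lt_two_pow_self
  have hr4 : 2 ^ r ≤ 4 ^ r := Nat.pow_le_pow_left (by norm_num) r
  refine ⟨4 ^ r * 28, by omega, ?_⟩
  rintro ⟨x, y, z, w, hn, hS⟩
  have hM : a * x + b * y + c * z + d * w ≤ M := Finset.le_sup (f := id) hS
  have hx : 2 ^ r ≤ x := two_pow_le_of_sum_four_squares r hn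
  have hy : 2 ^ r ≤ y :=
    two_pow_le_of_sum_four_squares r (y := x) (z := z) (w := w) (by rw [hn]; ring)
  have hz : 2 ^ r ≤ z :=
    two_pow_le_of_sum_four_squares r (y := x) (z := y) (w := w) (by rw [hn]; ring)
  have hw : 2 ^ r ≤ w :=
    two_pow_le_of_sum_four_squares r (y := x) (z := y) (w := z) (by rw [hn]; ring)
  have hpos : 1 ≤ a + b + c + d := by
    by_contra! hlt
    obtain ⟨rfl, rfl, rfl, rfl⟩ : a = 0 ∧ b = 0 ∧ c = 0 ∧ d = 0 := by omega
    simp at h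
  have hle : 2 ^ r ≤ a * x + b * y + c * z + d * w :=
    calc 2 ^ r ≤ (a + b + c + d) * 2 ^ r := Nat.le_mul_of_pos_left _ hpos
      _ = a * 2 ^ r + b * 2 ^ r + c * 2 ^ r + d * 2 ^ r := by ring
      _ ≤ a * x + b * y + c * z + d * w := by gcongr
  omega
end
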